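/- arXiv:2603.29905 — 3 statements merged into one kernel-verified Lean document; each statement's English description precedes it below -/
import Mathlib

section
/- Let p be a prime number and let χ : ℤ_p → ℚ_p^× be an injective p-adic character on ℤ_p. For any natural number n, the set R of all functions g : ℤ_p^n → ℚ_p for which there exist a natural number d, a matrix A ∈ M_{d×n}(ℤ_p), and a row vector C ∈ M_{1×d}(ℚ_p) with g(x) = C·χ(Ax) for all x ∈ ℤ_p^n (χ applied entrywise) is dense in the space C(ℤ_p^n, ℚ_p) of continuous functions with respect to the supremum norm. -/
/-- A closed subalgebra of `C(X, ℚ_p)` is stable under continuous functional calculus for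
`ℤ_p`-valued functions. -/
lemma Subalgebra.comp_padicInt_mem {p : ℕ} [Fact p.Prime] {X : Type*} [TopologicalSpace X]
    (B : Subalgebra ℚ_[p] C(X, ℚ_[p])) (hB : IsClosed (B : Set C(X, ℚ_[p])))
    (f : C(X, ℤ_[p])) {F : C(X, ℚ_[p])} (hF : F ∈ B) (hfF : ∀ x, F x = f x)
    (φ : C(ℤ_[p], ℚ_[p])) : φ.comp f ∈ B := by
  have : IsBoundedSMul ℤ_[p] ℚ_[p] := .of_norm_smul_le fun r x ↦ by
    rw [Algebra.smul_def, norm_mul]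
    rfl
  have hsum := (PadicInt.hasSum_mahler φ).map (ContinuousMap.compRightAlgHom ℚ_[p] ℚ_[p] f)
    (ContinuousMap.continuous_precomp f)
  refine hB.mem_of_tendsto hsum (Filter.Eventually.of_forall fun s ↦ sum_mem fun k _ ↦ ?_)
  set a : ℚ_[p] := (fwdDiff 1)^[k] (⇑φ) 0
  let q : Polynomial ℚ_[p] := descPochhammer ℚ_[p] k
  have hq : Polynomial.aeval F q ∈ B := by
    have := (Polynomial.aeval (⟨F, hF⟩ : B) q).2
    rwa [← Subalgebra.aeval_coe] at this
  convert B.smul_mem hq (a * (k.factorial : ℚ_[p])⁻¹) using 1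
  ext x
  have h1 : (Polynomial.aeval F q) x = Polynomial.eval (f x : ℚ_[p]) q := by
    rw [← hfF, ← Polynomial.coe_aeval_eq_eval]
    exact (Polynomial.aeval_algHom_apply (ContinuousMap.evalAlgHom ℚ_[p] ℚ_[p] x) F q).symm
  have h2 : Polynomial.eval (f x : ℚ_[p]) q = k.factorial * (Ring.choose (f x) k : ℤ_[p]) := by
    have h3 := congrArg (PadicInt.Coe.ringHom (p := p))
      (Ring.descPochhammer_eq_factorial_smul_choose (f x) k)
    rw [← Polynomial.aeval_eq_smeval, Polynomial.aeval_def, Polynomial.hom_eval₂,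
      RingHom.ext_int (PadicInt.Coe.ringHom.comp _) (Int.castRingHom ℚ_[p])] at h3
    simp only [q]
    rw [← descPochhammer_map (Int.castRingHom ℚ_[p]), Polynomial.eval_map]
    rw [nsmul_eq_mul, map_mul, map_natCast] at h3
    exact h3
  have h0 : (k.factorial : ℚ_[p]) ≠ 0 := mod_cast k.factorial_ne_zero
  change PadicInt.mahlerTerm a k (f x) = (a * (k.factorial : ℚ_[p])⁻¹) * (Polynomial.aeval F q) x
  rw [h1, h2, PadicInt.mahlerTerm_apply, mahler_apply, Algebra.smul_def]
  change ((Ring.choose (f x) k : ℤ_[p]) : ℚ_[p]) * a = _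
  field_simp

/-- If a subalgebra of `C(X, ℚ_p)` contains a function separating `x` from `y`, then its closure
contains the indicator function of a clopen set separating them. -/
lemma Subalgebra.exists_isClopen_charFn_mem {p : ℕ} [Fact p.Prime] {X : Type*}
    [TopologicalSpace X] [CompactSpace X] (B : Subalgebra ℚ_[p] C(X, ℚ_[p]))
    (hB : IsClosed (B : Set C(X, ℚ_[p]))) {F : C(X, ℚ_[p])} (hF : F ∈ B) {x y : X}
    (hxy : F x ≠ F y) :
    ∃ U : Set X, IsClopen U ∧ (∃ e ∈ B, (e : X → ℚ_[p]) = U.indicator 1) ∧ y ∈ U ∧ x ∉ U := by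
  obtain ⟨c, hc0, hc⟩ : ∃ c : ℚ_[p], c ≠ 0 ∧ ∀ z, ‖c * F z‖ ≤ 1 := by
    obtain ⟨c, hc0, hc⟩ := NormedField.exists_norm_lt ℚ_[p] (r := (‖F‖ + 1)⁻¹) (by positivity)
    refine ⟨c, norm_pos_iff.1 hc0, fun z ↦ ?_⟩
    rw [norm_mul]
    calc ‖c‖ * ‖F z‖ ≤ (‖F‖ + 1)⁻¹ * (‖F‖ + 1) := by
          gcongr
          exact (F.norm_coe_le_norm z).trans (by linarith)
      _ = 1 := inv_mul_cancel₀ (by positivity)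
  let f : C(X, ℤ_[p]) := ⟨fun z ↦ ⟨c * F z, hc z⟩, by fun_prop⟩
  have hne : f y ≠ f x := fun h ↦ hxy
    (mul_left_cancel₀ hc0 (congrArg (Subtype.val) h)).symm
  let V : Set ℤ_[p] := Metric.ball (f y) (dist (f x) (f y))
  have hV : IsClopen V := IsUltrametricDist.isClopen_ball _ _
  refine ⟨f ⁻¹' V, hV.preimage f.continuous,
    ⟨_, B.comp_padicInt_mem hB f (B.smul_mem hF c) (fun z ↦ rfl)
      (LocallyConstant.charFn ℚ_[p] hV : C(ℤ_[p], ℚ_[p])), ?_⟩, ?_, ?_⟩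
  · rfl
  · simpa [V] using hne.symm
  · simp [V]

/-- The `p`-adic Stone–Weierstrass theorem. -/
theorem Subalgebra.topologicalClosure_eq_top_of_separatesPoints_padic {p : ℕ} [Fact p.Prime]
    {X : Type*} [TopologicalSpace X] [CompactSpace X] (A : Subalgebra ℚ_[p] C(X, ℚ_[p]))
    (hA : A.SeparatesPoints) : A.topologicalClosure = ⊤ := by
  set B := A.topologicalClosure
  have hB : IsClosed (B : Set C(X, ℚ_[p])) := A.isClosed_topologicalClosure
  let S : Set X → Prop := fun U ↦ IsClopen U ∧ ∃ e ∈ B, (e : X → ℚ_[p]) = U.indicator 1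
  have hS_compl : ∀ U, S U → S Uᶜ := by
    rintro U ⟨hU, e, he, heU⟩
    refine ⟨hU.compl, 1 - e, B.sub_mem B.one_mem he, ?_⟩
    ext x
    by_cases hx : x ∈ U <;> simp [heU, hx]
  have hS_union : ∀ U V, S U → S V → S (U ∪ V) := by
    rintro U V ⟨hU, e, he, heU⟩ ⟨hV, e', he', heV⟩
    refine ⟨hU.union hV, e + e' - e * e',
      B.sub_mem (B.add_mem he he') (B.mul_mem he he'), ?_⟩
    ext x
    by_cases hx : x ∈ U <;> by_cases hx' : x ∈ V <;> simp [heU, heV, hx, hx']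
  have hS_empty : S ∅ := ⟨isClopen_empty, 0, B.zero_mem, by ext; simp⟩
  have hS_sep : ∀ x y, x ≠ y → ∃ U, S U ∧ y ∈ U ∧ x ∉ U := by
    intro x y hxy
    obtain ⟨_, ⟨F, hF, rfl⟩, hne⟩ := hA hxy
    obtain ⟨U, hU, he, hy, hx⟩ :=
      B.exists_isClopen_charFn_mem hB (A.le_topologicalClosure hF) hne
    exact ⟨U, ⟨hU, he⟩, hy, hx⟩
  have hS_nhds : ∀ (x : X) (W : Set X), IsOpen W → x ∈ W → ∃ U, S U ∧ x ∈ U ∧ U ⊆ W := by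
    intro x W hW hxW
    obtain ⟨V, hV, hWV, hxV⟩ : ∃ V, S V ∧ Wᶜ ⊆ V ∧ x ∉ V := by
      refine hW.isClosed_compl.isCompact.induction_on
        (p := fun K ↦ ∃ V, S V ∧ K ⊆ V ∧ x ∉ V) ⟨∅, hS_empty, le_rfl, id⟩ ?_ ?_ ?_
      · rintro s t hst ⟨V, hV, htV, hxV⟩
        exact ⟨V, hV, hst.trans htV, hxV⟩
      · rintro s t ⟨V, hV, hsV, hxV⟩ ⟨V', hV', htV', hxV'⟩
        exact ⟨V ∪ V', hS_union _ _ hV hV', Set.union_subset_union hsV htV',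
          fun h ↦ h.elim hxV hxV'⟩
      · intro y hy
        obtain ⟨U, hU, hyU, hxU⟩ := hS_sep x y (fun h ↦ hy (h ▸ hxW))
        exact ⟨U, mem_nhdsWithin_of_mem_nhds (hU.1.isOpen.mem_nhds hyU), U, hU, le_rfl, hxU⟩
    exact ⟨Vᶜ, hS_compl V hV, hxV, Set.compl_subset_comm.1 hWV⟩
  refine eq_top_iff.2 fun g _ ↦ ?_
  change g ∈ (B : Set C(X, ℚ_[p]))
  rw [← hB.closure_eq, Metric.mem_closure_iff]
  intro ε hε
  obtain ⟨U, -, f, hf, hU, hfU⟩ : ∃ U, S U ∧ ∃ f ∈ B, Set.univ ⊆ U ∧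
      ∀ x ∈ U, dist (g x) (f x) < ε := by
    refine isCompact_univ.induction_on
      (p := fun K ↦ ∃ U, S U ∧ ∃ f ∈ B, K ⊆ U ∧ ∀ x ∈ U, dist (g x) (f x) < ε)
      ⟨∅, hS_empty, 0, B.zero_mem, le_rfl, fun _ h ↦ h.elim⟩ ?_ ?_ ?_
    · rintro s t hst ⟨U, hU, f, hf, htU, hfU⟩
      exact ⟨U, hU, f, hf, hst.trans htU, hfU⟩
    · rintro s t ⟨U, hU, f, hf, hsU, hfU⟩ ⟨V, hV, f', hf', htV, hfV⟩
      obtain ⟨-, e, he, heU⟩ := id hU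
      refine ⟨U ∪ V, hS_union _ _ hU hV, e * f + (1 - e) * f',
        B.add_mem (B.mul_mem he hf) (B.mul_mem (B.sub_mem B.one_mem he) hf'),
        Set.union_subset_union hsU htV, fun x hx ↦ ?_⟩
      by_cases hxU : x ∈ U
      · simpa [heU, hxU] using hfU x hxU
      · simpa [heU, hxU] using hfV x (hx.resolve_left hxU)
    · intro x _
      obtain ⟨U, hU, hxU, hUW⟩ := hS_nhds x (g ⁻¹' Metric.ball (g x) ε)
        (Metric.isOpen_ball.preimage g.continuous) (Metric.mem_ball_self hε)
      exact ⟨U, mem_nhdsWithin_of_mem_nhds (hU.1.isOpen.mem_nhds hxU), U, hU,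
        algebraMap _ _ (g x), B.algebraMap_mem _, le_rfl, fun y hy ↦ hUW hy⟩
  exact ⟨f, hf, (ContinuousMap.dist_lt_iff hε).2 fun x ↦ hfU x (hU trivial)⟩

/-- Let `p` be a prime and `χ : ℤ_p → ℚ_p^×` an injective `p`-adic character.  For every
`n : ℕ`, the set of continuous functions `g : ℤ_p^n → ℚ_p` of the form
`g x = C·χ(Ax)` for some `d : ℕ`, `A ∈ M_{d×n}(ℤ_p)` and row vector `C ∈ M_{1×d}(ℚ_p)`
(`χ` applied entrywise) is dense in `C(ℤ_p^n, ℚ_p)` for the supremum norm (the domain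
being compact, the compact-open topology on `C(ℤ_p^n, ℚ_p)` is that of the sup norm). -/
theorem padic_character_span_dense
    (p : ℕ) [Fact p.Prime] (χ : ℤ_[p] → ℚ_[p]ˣ)
    (hχ_cont : Continuous fun x : ℤ_[p] => (χ x : ℚ_[p]))
    (hχ_hom : ∀ x y : ℤ_[p], χ (x + y) = χ x * χ y)
    (hχ_inj : Function.Injective χ)
    (n : ℕ) :
    Dense {g : C((Fin n → ℤ_[p]), ℚ_[p]) |
      ∃ (d : ℕ) (A : Matrix (Fin d) (Fin n) ℤ_[p]) (C : Matrix (Fin 1) (Fin d) ℚ_[p]),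
        ∀ x : Fin n → ℤ_[p],
          g x = C.mulVec (fun i => (χ (A.mulVec x i) : ℚ_[p])) 0} := by
  let ψ (a : Fin n → ℤ_[p]) : C(Fin n → ℤ_[p], ℚ_[p]) :=
    ⟨fun x ↦ (χ (a ⬝ᵥ x) : ℚ_[p]), hχ_cont.comp (by unfold dotProduct; fun_prop)⟩
  have hχ_zero : χ 0 = 1 := by simpa using hχ_hom 0 0
  let M : Submonoid C(Fin n → ℤ_[p], ℚ_[p]) :=
    { carrier := Set.range ψ
      one_mem' := ⟨0, by ext x; simp [ψ, hχ_zero]⟩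
      mul_mem' := by
        rintro _ _ ⟨a, rfl⟩ ⟨b, rfl⟩
        exact ⟨a + b, by ext x; simp [ψ, add_dotProduct, hχ_hom]⟩ }
  have hsep : (Algebra.adjoin ℚ_[p] (M : Set C(Fin n → ℤ_[p], ℚ_[p]))).SeparatesPoints := by
    intro x y hxy
    obtain ⟨i, hi⟩ := Function.ne_iff.1 hxy
    refine ⟨_, ⟨ψ (Pi.single i 1), Algebra.subset_adjoin ⟨_, rfl⟩, rfl⟩, fun h ↦ hi ?_⟩
    exact hχ_inj (Units.ext (by simpa [ψ] using h))
  have hdense : Dense (Algebra.adjoin ℚ_[p] (M : Set C(Fin n → ℤ_[p], ℚ_[p])) :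
      Set C(Fin n → ℤ_[p], ℚ_[p])) := by
    rw [dense_iff_closure_eq, ← Subalgebra.topologicalClosure_coe,
      Subalgebra.topologicalClosure_eq_top_of_separatesPoints_padic _ hsep, Algebra.coe_top]
  refine hdense.mono fun g hg ↦ ?_
  have hspan : g ∈ Submodule.span ℚ_[p] (Set.range ψ) := by
    have h : g ∈ Subalgebra.toSubmodule (Algebra.adjoin ℚ_[p] (M : Set _)) := hg
    rwa [Algebra.adjoin_eq_span, Submonoid.closure_eq] at h
  obtain ⟨d, c, m, rfl⟩ := Submodule.mem_span_set'.1 hspan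
  choose a ha using fun i ↦ (m i).2
  refine ⟨d, Matrix.of a, Matrix.of fun _ ↦ c, fun x ↦ ?_⟩
  simp [← ha, ψ, Matrix.mulVec, dotProduct, ContinuousMap.sum_apply]
end

section
/- Let p be a prime number. If y ∈ ℚ_p^× satisfies y^{p^e} = 1 for some natural number e, then y = 1, or p = 2 and y = −1. In particular, ℚ_p^× admits at most two elements of p-power order. -/
namespace PadicInt

theorem eq_one_of_pow_prime_pow_eq_one {p : ℕ} [Fact p.Prime] (hp : Odd p) {z : ℤ_[p]} {e : ℕ}
    (h : z ^ p ^ e = 1) : z = 1 := by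
  have hmod : toZMod z = 1 := by
    rw [← ZMod.pow_card_pow (n := e) (toZMod z), ← map_pow, h, map_one]
  have hdvd : (p : ℤ_[p]) ∣ z - 1 := by
    rw [← Ideal.mem_span_singleton, ← maximalIdeal_eq_span_p, ← ker_toZMod, RingHom.mem_ker,
      map_sub, map_one, hmod, sub_self]
  have hz : ¬(p : ℤ_[p]) ∣ z := fun hpz =>
    prime_p.not_dvd_one ((dvd_sub_right hpz).mp hdvd)
  have hmult := emultiplicity_pow_prime_pow_sub_pow_prime_pow prime_p hp hdvd hz e
  rw [one_pow, h, sub_self, emultiplicity_zero] at hmult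
  by_contra hne
  have hfin : FiniteMultiplicity (p : ℤ_[p]) (z - 1) :=
    .of_prime_left prime_p (sub_ne_zero.mpr hne)
  rw [hfin.emultiplicity_eq_multiplicity] at hmult
  exact ENat.natCast_ne_top _ (by exact_mod_cast hmult.symm)

theorem sq_ne_neg_one (z : ℤ_[2]) : z ^ 2 ≠ -1 := by
  intro h
  have hmod := congrArg (toZModPow (p := 2) 2) h
  rw [map_pow, map_neg, map_one] at hmod
  have key : ∀ a : ZMod (2 ^ 2), a ^ 2 ≠ -1 := by decide
  exact key _ hmod

theorem eq_one_or_eq_neg_one_of_pow_two_pow_eq_one {e : ℕ} {z : ℤ_[2]} (h : z ^ 2 ^ e = 1) :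
    z = 1 ∨ z = -1 := by
  induction e generalizing z with
  | zero => exact .inl (by simpa using h)
  | succ e ih =>
    rw [pow_succ', pow_mul] at h
    have hsq : z ^ 2 = 1 := (ih h).resolve_right (sq_ne_neg_one z)
    exact eq_or_eq_neg_of_sq_eq_sq z 1 (by rw [hsq, one_pow])

end PadicInt

/-- Let `p` be a prime.  If `y ∈ ℚ_p^×` satisfies `y ^ (p ^ e) = 1` for some `e : ℕ`,
then `y = 1`, or `p = 2` and `y = −1`.  In particular `ℚ_p^×` admits at most two
elements of `p`-power order. -/
theorem padic_p_power_roots_of_unity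
    (p : ℕ) [Fact p.Prime] (y : ℚ_[p]) (hy : y ≠ 0) (e : ℕ)
    (h : y ^ p ^ e = 1) :
    y = 1 ∨ (p = 2 ∧ y = -1) := by
  have hnorm : ‖y‖ = 1 := by
    refine (pow_eq_one_iff_of_nonneg (norm_nonneg y)
      (pow_ne_zero e (Fact.out : p.Prime).ne_zero)).mp ?_
    rw [← norm_pow, h, norm_one]
  obtain ⟨z, rfl⟩ : ∃ z : ℤ_[p], (z : ℚ_[p]) = y := ⟨⟨y, hnorm.le⟩, rfl⟩
  have hz : z ^ p ^ e = 1 := Subtype.coe_injective (by push_cast; exact h)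
  rcases (Fact.out : p.Prime).eq_two_or_odd' with rfl | hodd
  · rcases PadicInt.eq_one_or_eq_neg_one_of_pow_two_pow_eq_one hz with rfl | rfl
    · exact .inl PadicInt.coe_one
    · exact .inr ⟨rfl, by push_cast; rfl⟩
  · exact .inl (by rw [PadicInt.eq_one_of_pow_prime_pow_eq_one hodd hz, PadicInt.coe_one])
end

section
/- Let p be a prime number and let a ∈ 1 + pℤ_p. For all x, y ∈ ℤ_p, a^{x+y} = a^x · a^y, where a^z denotes the sum of the convergent series Σ_{e=0}^{∞} C(z,e)·(a−1)^e. In particular, x ↦ a^x is a p-adic character on ℤ_p. -/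
/-- The binomial coefficient function `C(x,e) = (e!)⁻¹ ∏_{i=0}^{e-1} (x − i)` of a
`p`-adic integer `x`, with value in `ℚ_p`. -/
noncomputable def padicBinom (p : ℕ) [Fact p.Prime] (x : ℤ_[p]) (e : ℕ) : ℚ_[p] :=
  (∏ i ∈ Finset.range e, ((x : ℚ_[p]) - (i : ℚ_[p]))) / (e.factorial : ℚ_[p])

/-- `a^z` for `a ∈ 1 + pℤ_p` and `z ∈ ℤ_p`: the sum of the convergent Mahler series
`Σ_{e=0}^{∞} C(z,e)·(a−1)^e`. -/
noncomputable def padicPow (p : ℕ) [Fact p.Prime] (a : ℚ_[p]) (z : ℤ_[p]) : ℚ_[p] :=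
  ∑' e : ℕ, padicBinom p z e * (a - 1) ^ e

theorem padicBinom_eq_choose (p : ℕ) [Fact p.Prime] (x : ℤ_[p]) (e : ℕ) :
    padicBinom p x e = (Ring.choose x e : ℤ_[p]) := by
  have h := Ring.descPochhammer_eq_factorial_smul_choose x e
  rw [← Polynomial.aeval_eq_smeval, Polynomial.aeval_def, ← Polynomial.eval_map,
    descPochhammer_map, descPochhammer_eval_eq_prod_range, nsmul_eq_mul] at h
  have hcast := congrArg (algebraMap ℤ_[p] ℚ_[p]) h
  simp only [map_prod, map_sub, map_mul, map_natCast, PadicInt.algebraMap_apply] at hcast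
  rw [padicBinom, hcast]
  exact mul_div_cancel_left₀ _ (Nat.cast_ne_zero.mpr e.factorial_ne_zero)

instance PadicInt.isBoundedSMul_padic (p : ℕ) [Fact p.Prime] : IsBoundedSMul ℤ_[p] ℚ_[p] :=
  .of_norm_smul_le fun r x => by
    rw [Algebra.smul_def, PadicInt.algebraMap_apply, norm_mul, PadicInt.norm_def]

theorem padicPow_eq_addChar (p : ℕ) [Fact p.Prime] (a : ℚ_[p])
    (ha : Filter.Tendsto ((a - 1) ^ ·) Filter.atTop (nhds 0)) :
    padicPow p a = PadicInt.addChar_of_value_at_one (p := p) (a - 1) ha := by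
  ext x
  rw [PadicInt.coe_addChar_of_value_at_one, PadicInt.mahlerSeries_apply ha, padicPow]
  simp only [padicBinom_eq_choose, mahler_apply, Algebra.smul_def, PadicInt.algebraMap_apply]

/-- Let `p` be a prime and `a ∈ 1 + pℤ_p`.  For all `x, y ∈ ℤ_p` one has
`a^{x+y} = a^x · a^y`, where `a^z` is the sum of the series `Σ_e C(z,e)·(a−1)^e`.
In particular `x ↦ a^x` is a `p`-adic character on `ℤ_p`: it is a continuous group
homomorphism from the additive group `ℤ_p` to `ℚ_p^×` (its values are nonzero). -/
theorem padic_pow_add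
    (p : ℕ) [Fact p.Prime] (a : ℚ_[p]) (ha : ‖a - 1‖ ≤ (p : ℝ)⁻¹) :
    (∀ x y : ℤ_[p], padicPow p a (x + y) = padicPow p a x * padicPow p a y) ∧
    Continuous (padicPow p a) ∧
    (∀ x : ℤ_[p], padicPow p a x ≠ 0) := by
  have hp : (p : ℝ)⁻¹ < 1 :=
    inv_lt_one_of_one_lt₀ (mod_cast (Fact.out : p.Prime).one_lt)
  have hlim := tendsto_pow_atTop_nhds_zero_of_norm_lt_one (ha.trans_lt hp)
  rw [padicPow_eq_addChar p a hlim]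
  exact ⟨AddChar.map_add_eq_mul _, PadicInt.continuous_addChar_of_value_at_one hlim,
    fun x => (AddChar.val_isUnit _ x).ne_zero⟩
end
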